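/- Let {G_n}_{n∈ℕ} be a sequence of simple ordered graphs with |V(G_n)| → ∞ such that for every simple ordered graph F the sequence t(F, G_n) converges. Then there exists an orderon W such that t(F, G_n) → t(F, W) for every simple ordered graph F. -/

import Mathlib

open MeasureTheory Real Filter
open scoped ENNReal Classical

noncomputable section

/-- The unit interval `[0,1]` as a subtype of `ℝ`. -/
abbrev UI : Type := Set.Icc (0:ℝ) 1

/-- The unit square `[0,1]²`. -/
abbrev USq : Type := UI × UI

/-- An orderon: a symmetric measurable function `([0,1]²)² → [0,1]`. -/
def IsOrderon (W : USq → USq → ℝ) : Prop :=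
  Measurable (Function.uncurry W) ∧ (∀ u v, W u v ∈ Set.Icc (0:ℝ) 1) ∧
    ∀ u v, W u v = W v u

/-- The (unordered) cut norm: `sup_{S,T} |∫_{S×T} W|` over measurable `S,T ⊆ [0,1]²`. -/
def cutNorm (W : USq → USq → ℝ) : ℝ :=
  sSup {x | ∃ S T : Set USq, MeasurableSet S ∧ MeasurableSet T ∧
    x = |∫ p in S ×ˢ T, W p.1 p.2|}

/-- The (induced) homomorphism density `t(F,W)` of a simple ordered graph `F` on `[k]`
(encoded as a `SimpleGraph (Fin k)`, the vertex order being that of `Fin k`) in `W`. -/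
def homDensity {k : ℕ} (F : SimpleGraph (Fin k)) (W : USq → USq → ℝ) : ℝ :=
  (k.factorial : ℝ) * ∫ v : Fin k → USq,
    ∏ p ∈ Finset.univ.filter (fun p : Fin k × Fin k => p.1 < p.2),
      ((if F.Adj p.1 p.2 then W (v p.1) (v p.2) else 1 - W (v p.1) (v p.2)) *
        (if ((v p.1).1 : ℝ) ≤ ((v p.2).1 : ℝ) then 1 else 0))

/-- `Q_n(z) = ⌈nz⌉` for `z ∈ (0,1]`, and `Q_n(0) = 1`. -/
def Qn (n : ℕ) (x : ℝ) : ℕ := max 1 ⌈(n : ℝ) * x⌉₊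

/-- The naive `n`-block orderon of a weighted ordered graph `G : [n]² → [0,1]`
(given as a function `ℕ → ℕ → ℝ`, 1-indexed). -/
def blockOrderon (n : ℕ) (G : ℕ → ℕ → ℝ) : USq → USq → ℝ :=
  fun u v => G (Qn n (u.1 : ℝ)) (Qn n (v.1 : ℝ))

/-- The (1-indexed, real-valued) adjacency function of a simple ordered graph on `[n]`. -/
def graphAdjFun {n : ℕ} (G : SimpleGraph (Fin n)) : ℕ → ℕ → ℝ :=
  fun i j => if h : i - 1 < n ∧ j - 1 < n then
    (if G.Adj ⟨i - 1, h.1⟩ ⟨j - 1, h.2⟩ then 1 else 0) else 0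

/-- The naive block orderon `W_G` representing a simple ordered graph `G` on `[n]`. -/
def graphOrderon {n : ℕ} (G : SimpleGraph (Fin n)) : USq → USq → ℝ :=
  blockOrderon n (graphAdjFun G)

namespace Orderon

open ProbabilityTheory BoundedContinuousFunction

/-! ### Labelled random arrays -/

/-- Vertices of an infinite sample: `Sum.inl` are the vertices at which subgraph densities are
read off, the other two copies of `ℕ` are reference vertices. -/
abbrev Vtx : Type := ℕ ⊕ ℕ ⊕ ℕ

/-- Arrays consisting of a label for every vertex and a weight for every ordered pair. -/
abbrev Arr : Type := (Vtx → UI) × (Vtx → Vtx → UI)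

/-- Pull an array back along a map of vertices. -/
def relabel (σ : Vtx → Vtx) (ω : Arr) : Arr :=
  (fun v => ω.1 (σ v), fun u v => ω.2 (σ u) (σ v))

/-- Replace the labels in `N` and the weights in `S` by `0`. -/
def erase (N : Set Vtx) (S : Set (Vtx × Vtx)) (ω : Arr) : Arr :=
  (fun v => if v ∈ N then 0 else ω.1 v, fun u v => if (u, v) ∈ S then 0 else ω.2 u v)

/-- Erase all information about the vertices in `N`. -/
def erasePts (N : Set Vtx) : Arr → Arr := erase N {e | e.1 ∈ N ∨ e.2 ∈ N}

/-- Erase the weights of all pairs with both entries in `{i, j}`. -/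
def erasePair (i j : Vtx) : Arr → Arr :=
  erase ∅ {e | (e.1 = i ∨ e.1 = j) ∧ (e.2 = i ∨ e.2 = j)}

/-- The vertices at which subgraph densities are read off. -/
def base : Set Vtx := Set.range Sum.inl

lemma continuous_relabel (σ : Vtx → Vtx) : Continuous (relabel σ) := by
  unfold relabel; fun_prop

lemma continuous_erase (N : Set Vtx) (S : Set (Vtx × Vtx)) : Continuous (erase N S) := by
  unfold erase
  refine .prodMk (continuous_pi fun v => ?_) (continuous_pi fun u => continuous_pi fun v => ?_)
  · split_ifs <;> fun_prop
  · split_ifs <;> fun_prop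

lemma continuous_erasePts (N : Set Vtx) : Continuous (erasePts N) := continuous_erase _ _

@[fun_prop]
lemma measurable_relabel (σ : Vtx → Vtx) : Measurable (relabel σ) :=
  (continuous_relabel σ).measurable

@[fun_prop]
lemma measurable_erasePts (N : Set Vtx) : Measurable (erasePts N) :=
  (continuous_erase _ _).measurable

@[fun_prop]
lemma measurable_erasePair (i j : Vtx) : Measurable (erasePair i j) :=
  (continuous_erase _ _).measurable

/-- The factor contributed by the pair `p` to the induced density of `F`, for a pair of weight
`w`. -/
def edgeFactor {k : ℕ} (F : SimpleGraph (Fin k)) (p : Fin k × Fin k) (w : ℝ) : ℝ :=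
  if F.Adj p.1 p.2 then w else 1 - w

/-- Indicator of `x` being nondecreasing. -/
def orderInd {k : ℕ} (x : Fin k → UI) : ℝ :=
  ∏ p ∈ Finset.univ.filter (fun p : Fin k × Fin k => p.1 < p.2),
    if ((x p.1 : ℝ)) ≤ (x p.2 : ℝ) then 1 else 0

/-- The integrand of the density of `F`, evaluated at the base vertices of an array. -/
def pattern {k : ℕ} (F : SimpleGraph (Fin k)) (ω : Arr) : ℝ :=
  (∏ p ∈ Finset.univ.filter (fun p : Fin k × Fin k => p.1 < p.2),
    edgeFactor F p (ω.2 (.inl p.1) (.inl p.2))) * orderInd fun i : Fin k => ω.1 (.inl i)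

@[fun_prop]
lemma continuous_edgeFactor {k : ℕ} (F : SimpleGraph (Fin k)) (p : Fin k × Fin k) :
    Continuous (edgeFactor F p) := by
  unfold edgeFactor; split_ifs <;> fun_prop

@[fun_prop]
lemma measurable_edgeFactor {k : ℕ} (F : SimpleGraph (Fin k)) (p : Fin k × Fin k) :
    Measurable (edgeFactor F p) := (continuous_edgeFactor F p).measurable

lemma edgeFactor_mem {k : ℕ} (F : SimpleGraph (Fin k)) (p : Fin k × Fin k) {w : ℝ}
    (hw : w ∈ Set.Icc (0 : ℝ) 1) : edgeFactor F p w ∈ Set.Icc (0 : ℝ) 1 := by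
  unfold edgeFactor; obtain ⟨h0, h1⟩ := hw
  split_ifs <;> constructor <;> linarith

@[fun_prop]
lemma measurable_orderInd {k : ℕ} : Measurable (orderInd (k := k)) := by
  unfold orderInd
  refine Finset.measurable_prod _ fun p _ => ?_
  exact Measurable.ite (measurableSet_le (by fun_prop) (by fun_prop)) (by fun_prop) (by fun_prop)

lemma prod_mem_Icc {ι : Type*} {s : Finset ι} {f : ι → ℝ}
    (hf : ∀ i ∈ s, f i ∈ Set.Icc (0 : ℝ) 1) : ∏ i ∈ s, f i ∈ Set.Icc (0 : ℝ) 1 :=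
  ⟨Finset.prod_nonneg fun i hi => (hf i hi).1,
    Finset.prod_le_one (fun i hi => (hf i hi).1) fun i hi => (hf i hi).2⟩

lemma orderInd_mem {k : ℕ} (x : Fin k → UI) : orderInd x ∈ Set.Icc (0 : ℝ) 1 :=
  prod_mem_Icc fun p _ => by split_ifs <;> simp

lemma abs_le_one_of_mem {x : ℝ} (hx : x ∈ Set.Icc (0 : ℝ) 1) : |x| ≤ 1 :=
  abs_le.2 ⟨by linarith [hx.1], hx.2⟩

@[fun_prop]
lemma measurable_pattern {k : ℕ} (F : SimpleGraph (Fin k)) : Measurable (pattern F) := by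
  unfold pattern
  refine .mul (Finset.measurable_prod _ fun p _ => by fun_prop) (by fun_prop)

lemma homDensity_eq {k : ℕ} (F : SimpleGraph (Fin k)) (W : USq → USq → ℝ) :
    homDensity F W = (k.factorial : ℝ) * ∫ v : Fin k → USq,
      (∏ p ∈ Finset.univ.filter (fun p : Fin k × Fin k => p.1 < p.2),
        edgeFactor F p (W (v p.1) (v p.2))) * orderInd fun i => (v i).1 := by
  simp only [homDensity, edgeFactor, orderInd, Finset.prod_mul_distrib]

/-! ### Laws of samples and their limits -/

/-- The properties of the law of an infinite sample from an orderon which are preserved under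
weak limits. -/
structure IsSampleLike (P : Measure Arr) : Prop where
  map_relabel : ∀ σ : Vtx → Vtx, Function.Injective σ → P.map (relabel σ) = P
  indep : P.map (fun ω => (erasePts baseᶜ ω, erasePts base ω)) =
    (P.map (erasePts baseᶜ)).prod (P.map (erasePts base))
  map_label : P.map Prod.fst = Measure.infinitePi fun _ : Vtx => (volume : Measure UI)
  symm : ∀ u v, ∀ᵐ ω ∂P, ω.2 u v = ω.2 v u

/-- The array of labels and weights of a family of points of an orderon. -/
def sampleArr {W : USq → USq → ℝ} (hW : IsOrderon W) (x : Vtx → USq) : Arr :=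
  (fun v => (x v).1, fun u v => ⟨W (x u) (x v), hW.2.1 _ _⟩)

@[fun_prop]
lemma measurable_sampleArr {W : USq → USq → ℝ} (hW : IsOrderon W) :
    Measurable (sampleArr hW) := by
  unfold sampleArr
  refine .prodMk (by fun_prop) (measurable_pi_lambda _ fun u => measurable_pi_lambda _ fun v => ?_)
  exact Measurable.subtype_mk (hW.1.comp (by fun_prop : Measurable fun x : Vtx → USq => (x u, x v)))

/-- The law of an infinite sample from an orderon. -/
def sampleLaw {W : USq → USq → ℝ} (hW : IsOrderon W) : ProbabilityMeasure Arr :=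
  ⟨(Measure.infinitePi fun _ : Vtx => (volume : Measure USq)).map (sampleArr hW),
    Measure.isProbabilityMeasure_map (by fun_prop)⟩

lemma indepFun_restrict {ι E : Type*} [MeasurableSpace E] (μ : Measure E) [IsProbabilityMeasure μ]
    {S T : Set ι} (h : Disjoint S T) :
    IndepFun S.domRestrict T.domRestrict (Measure.infinitePi fun _ : ι => μ) := by
  have hi := (iIndepFun_infinitePi (P := fun _ : ι => μ) (X := fun _ x => x)
    (fun _ => measurable_id)).iIndep
  have := indep_iSup_of_disjoint (fun i => (measurable_pi_apply i).comap_le) hi h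
  rw [IndepFun_iff_Indep]
  convert this using 1 <;>
  · simp only [MeasurableSpace.pi, MeasurableSpace.comap_iSup, MeasurableSpace.comap_comp,
      iSup_subtype]
    rfl

lemma erasePts_sampleArr_congr {W : USq → USq → ℝ} (hW : IsOrderon W) {N : Set Vtx}
    {x y : Vtx → USq} (h : ∀ v, v ∉ N → x v = y v) :
    erasePts N (sampleArr hW x) = erasePts N (sampleArr hW y) := by
  unfold erasePts erase sampleArr
  ext u v
  · by_cases hu : u ∈ N <;> simp [hu, h]
  · by_cases hu : u ∈ N <;> by_cases hv : v ∈ N <;> simp [hu, hv, h]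

lemma isSampleLike_sampleLaw {W : USq → USq → ℝ} (hW : IsOrderon W) :
    IsSampleLike (sampleLaw hW) where
  map_relabel σ hσ := by
    simp only [sampleLaw, ProbabilityMeasure.coe_mk]
    conv_rhs => rw [← Measure.map_infinitePi_infinitePi_of_inj
      (P := fun _ : Vtx => (volume : Measure USq)) hσ]
    rw [Measure.map_map (by fun_prop) (by fun_prop), Measure.map_map (by fun_prop) (by fun_prop)]
    rfl
  indep := by
    simp only [sampleLaw, ProbabilityMeasure.coe_mk]
    rw [Measure.map_map (by fun_prop) (by fun_prop), Measure.map_map (by fun_prop) (by fun_prop),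
      Measure.map_map (by fun_prop) (by fun_prop)]
    refine (indepFun_iff_map_prod_eq_prod_map_map (by fun_prop) (by fun_prop)).1 ?_
    have key := indepFun_restrict (volume : Measure USq) (disjoint_compl_right (a := base))
    let ext (S : Set Vtx) (x : S → USq) : Vtx → USq := fun v => if h : v ∈ S then x ⟨v, h⟩ else 0
    have hext (S : Set Vtx) : Measurable (ext S) := by
      refine measurable_pi_lambda _ fun v => ?_
      by_cases h : v ∈ S
      · simp only [ext, h, dite_true]; fun_prop
      · simp only [ext, h, dite_false]; fun_prop
    have h := key.comp (φ := fun x => erasePts baseᶜ (sampleArr hW (ext base x)))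
      (ψ := fun x => erasePts base (sampleArr hW (ext baseᶜ x))) (by fun_prop) (by fun_prop)
    refine h.congr (.of_forall fun x => ?_) (.of_forall fun x => ?_)
    · exact erasePts_sampleArr_congr hW fun v hv => by
        simp only [Set.mem_compl_iff, not_not] at hv; simp [ext, hv]
    · exact erasePts_sampleArr_congr hW fun v hv => by simp [ext, hv]
  map_label := by
    simp only [sampleLaw, ProbabilityMeasure.coe_mk]
    rw [Measure.map_map (by fun_prop) (by fun_prop)]
    refine (Measure.infinitePi_map_pi (fun _ : Vtx => (volume : Measure USq))
      (f := fun _ => Prod.fst) (fun _ => measurable_fst)).trans ?_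
    congr! with v
    exact measurePreserving_fst.map_eq
  symm u v := by
    simp only [sampleLaw, ProbabilityMeasure.coe_mk]
    rw [ae_map_iff (by fun_prop) (measurableSet_eq_fun (by fun_prop) (by fun_prop))]
    exact .of_forall fun x => Subtype.ext (hW.2.2 _ _)

lemma homDensity_eq_integral_sampleLaw {W : USq → USq → ℝ} (hW : IsOrderon W) {k : ℕ}
    (F : SimpleGraph (Fin k)) :
    homDensity F W = k.factorial * ∫ ω, pattern F ω ∂(sampleLaw hW : Measure Arr) := by
  rw [homDensity_eq]
  congr 1
  simp only [sampleLaw, ProbabilityMeasure.coe_mk]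
  rw [integral_map (by fun_prop) (by fun_prop)]
  have hinj : Function.Injective fun i : Fin k => (Sum.inl (i : ℕ) : Vtx) :=
    Sum.inl_injective.comp Fin.val_injective
  rw [volume_pi, ← Measure.infinitePi_eq_pi, ← Measure.map_infinitePi_infinitePi_of_inj
    (P := fun _ : Vtx => (volume : Measure USq)) hinj,
    integral_map (measurable_pi_lambda _ fun _ => measurable_pi_apply _).aemeasurable ?_]
  · rfl
  · refine Measurable.aestronglyMeasurable (.mul (Finset.measurable_prod _ fun p _ => ?_)
      (by fun_prop))
    exact (measurable_edgeFactor F p).comp (hW.1.comp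
      (by fun_prop : Measurable fun v : Fin k → USq => (v p.1, v p.2)))

section Limits

variable {ι : Type*} {l : Filter ι} {μ : ι → ProbabilityMeasure Arr}
  {P : ProbabilityMeasure Arr}

lemma tendsto_integral (h : Tendsto μ l (nhds P)) {f : Arr → ℝ} (hf : Continuous f) :
    Tendsto (fun i => ∫ ω, f ω ∂(μ i : Measure Arr)) l (nhds (∫ ω, f ω ∂(P : Measure Arr))) :=
  ProbabilityMeasure.tendsto_iff_forall_integral_tendsto.1 h (.mkOfCompact ⟨f, hf⟩)

lemma IsSampleLike.of_tendsto [l.NeBot] (h : Tendsto μ l (nhds P)) (hμ : ∀ i, IsSampleLike (μ i)) :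
    IsSampleLike P where
  map_relabel σ hσ := by
    refine ext_of_forall_integral_eq_of_IsFiniteMeasure fun f => ?_
    rw [integral_map (by fun_prop) (by fun_prop)]
    refine tendsto_nhds_unique (tendsto_integral h (f.continuous.comp (continuous_relabel σ)))
      ((tendsto_integral h f.continuous).congr fun i => ?_)
    conv_lhs => rw [← (hμ i).map_relabel σ hσ]
    rw [integral_map (by fun_prop) (by fun_prop)]
  indep := by
    refine Measure.eq_prod_of_integral_mul_boundedContinuousFunction fun f g => ?_
    rw [integral_map (by fun_prop) (by fun_prop), integral_map (by fun_prop) (by fun_prop),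
      integral_map (by fun_prop) (by fun_prop)]
    have hf := f.continuous.comp (continuous_erasePts baseᶜ)
    have hg := g.continuous.comp (continuous_erasePts base)
    refine tendsto_nhds_unique (tendsto_integral h (hf.mul hg))
      (((tendsto_integral h hf).mul (tendsto_integral h hg)).congr fun i => ?_)
    have hi := congrArg (fun m => ∫ p, f p.1 * g p.2 ∂m) (hμ i).indep
    simp only [integral_prod_mul] at hi
    rw [integral_map (by fun_prop) (by fun_prop), integral_map (by fun_prop) (by fun_prop),
      integral_map (by fun_prop) (by fun_prop)] at hi
    exact hi.symm
  map_label := by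
    refine ext_of_forall_integral_eq_of_IsFiniteMeasure fun f => ?_
    rw [integral_map (by fun_prop) (by fun_prop)]
    refine tendsto_nhds_unique (tendsto_integral h (f.continuous.comp continuous_fst))
      (tendsto_const_nhds.congr fun i => ?_)
    rw [← (hμ i).map_label, integral_map (by fun_prop) (by fun_prop)]
  symm u v := by
    have hc : Continuous fun ω : Arr => |(ω.2 u v : ℝ) - ω.2 v u| := by fun_prop
    have h0 : ∫ ω : Arr, |(ω.2 u v : ℝ) - ω.2 v u| ∂(P : Measure Arr) = 0 := by
      refine tendsto_nhds_unique (tendsto_integral h hc) (tendsto_const_nhds.congr fun i => ?_)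
      symm
      refine integral_eq_zero_of_ae ?_
      filter_upwards [(hμ i).symm u v] with ω hω
      simp [hω]
    rw [integral_eq_zero_iff_of_nonneg (fun _ => abs_nonneg _)
      ((BoundedContinuousFunction.mkOfCompact ⟨_, hc⟩).integrable _)] at h0
    filter_upwards [h0] with ω hω
    exact Subtype.ext (sub_eq_zero.1 (abs_eq_zero.1 hω))

/-- Weak convergence of laws with a common distribution of the labels extends to test functions
which are continuous in the weights but only measurable in the labels. -/
lemma tendsto_integral_mul_label (h : Tendsto μ l (nhds P)) {ν : Measure (Vtx → UI)}
    [IsProbabilityMeasure ν] (hμ : ∀ i, (μ i : Measure Arr).map Prod.fst = ν)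
    (hP : (P : Measure Arr).map Prod.fst = ν) {c : Arr → ℝ} (hc : Continuous c)
    (hc1 : ∀ ω, |c ω| ≤ 1) {b : (Vtx → UI) → ℝ} (hb : Measurable b) (hb1 : ∀ x, |b x| ≤ 1) :
    Tendsto (fun i => ∫ ω, c ω * b ω.1 ∂(μ i : Measure Arr)) l
      (nhds (∫ ω, c ω * b ω.1 ∂(P : Measure Arr))) := by
  have hbi : Integrable b ν := .of_bound hb.aestronglyMeasurable 1 (.of_forall hb1)
  have key : ∀ Q : ProbabilityMeasure Arr, (Q : Measure Arr).map Prod.fst = ν →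
      ∀ g : (Vtx → UI) →ᵇ ℝ, |(∫ ω, c ω * b ω.1 ∂(Q : Measure Arr)) -
        ∫ ω, c ω * g ω.1 ∂(Q : Measure Arr)| ≤ ∫ x, ‖b x - g x‖ ∂ν := by
    intro Q hQ g
    have hcb : Integrable (fun ω => c ω * b ω.1) (Q : Measure Arr) :=
      .of_bound (hc.measurable.mul (by fun_prop)).aestronglyMeasurable 1 (.of_forall fun ω => by
        simpa using mul_le_one₀ (hc1 ω) (abs_nonneg _) (hb1 ω.1))
    have hcg : Integrable (fun ω => c ω * g ω.1) (Q : Measure Arr) :=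
      (BoundedContinuousFunction.mkOfCompact
        ⟨_, hc.mul (g.continuous.comp continuous_fst)⟩).integrable _
    rw [← integral_sub hcb hcg, ← hQ, integral_map (by fun_prop) ?_]
    · refine (norm_integral_le_integral_norm _).trans (integral_mono_of_nonneg
        (.of_forall fun ω => norm_nonneg (c ω * b ω.1 - c ω * g ω.1)) ?_ (.of_forall fun ω => ?_))
      · have := (hbi.sub (g.integrable ν)).norm
        rw [← hQ] at this
        exact this.comp_measurable measurable_fst
      · simp only [← mul_sub, norm_mul]
        exact mul_le_of_le_one_left (norm_nonneg _) (hc1 ω)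
    · exact (hb.sub g.continuous.measurable).norm.aestronglyMeasurable
  rw [Metric.tendsto_nhds]
  intro ε hε
  obtain ⟨g, hg, -⟩ := hbi.exists_boundedContinuous_integral_sub_le (ε := ε / 3) (by positivity)
  have hlim := tendsto_integral h (hc.mul (g.continuous.comp continuous_fst))
  filter_upwards [Metric.tendsto_nhds.1 hlim (ε / 3) (by positivity)] with i hi
  have h1 := (key (μ i) (hμ i) g).trans hg
  have h2 := (key P hP g).trans hg
  rw [Real.dist_eq] at hi ⊢
  simp only [Pi.mul_apply, Function.comp_apply] at hi
  rw [abs_lt] at hi ⊢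
  rw [abs_le] at h1 h2
  constructor <;> linarith [h1.1, h1.2, h2.1, h2.2, hi.1, hi.2]

lemma tendsto_integral_pattern (h : Tendsto μ l (nhds P)) (hμ : ∀ i, IsSampleLike (μ i))
    (hP : IsSampleLike P) {k : ℕ} (F : SimpleGraph (Fin k)) :
    Tendsto (fun i => ∫ ω, pattern F ω ∂(μ i : Measure Arr)) l
      (nhds (∫ ω, pattern F ω ∂(P : Measure Arr))) := by
  refine tendsto_integral_mul_label (b := fun x => orderInd fun i : Fin k => x (.inl i)) h
    (fun i => (hμ i).map_label) hP.map_label (by fun_prop) (fun ω => ?_) (by fun_prop)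
    fun x => abs_le_one_of_mem (orderInd_mem _)
  exact abs_le_one_of_mem (prod_mem_Icc fun p _ => edgeFactor_mem F p (Subtype.property _))

end Limits

/-! ### Bounded measurable functions and conditioning -/

/-- Bounded measurable real functions. -/
structure BddMeas {α : Type*} [MeasurableSpace α] (f : α → ℝ) : Prop where
  measurable : Measurable f
  bdd : ∃ C, ∀ x, |f x| ≤ C

namespace BddMeas

variable {α β : Type*} [MeasurableSpace α] [MeasurableSpace β] {f g : α → ℝ}

lemma mul (hf : BddMeas f) (hg : BddMeas g) : BddMeas fun x => f x * g x := by
  obtain ⟨C, hC⟩ := hf.bdd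
  obtain ⟨D, hD⟩ := hg.bdd
  refine ⟨hf.measurable.mul hg.measurable, C * D, fun x => ?_⟩
  rw [abs_mul]
  exact mul_le_mul (hC x) (hD x) (abs_nonneg _) ((abs_nonneg _).trans (hC x))

lemma sub (hf : BddMeas f) (hg : BddMeas g) : BddMeas fun x => f x - g x := by
  obtain ⟨C, hC⟩ := hf.bdd
  obtain ⟨D, hD⟩ := hg.bdd
  exact ⟨hf.measurable.sub hg.measurable, C + D, fun x =>
    (abs_sub _ _).trans (add_le_add (hC x) (hD x))⟩

lemma const (c : ℝ) : BddMeas fun _ : α => c := ⟨measurable_const, |c|, fun _ => le_rfl⟩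

lemma comp (hf : BddMeas f) {φ : β → α} (hφ : Measurable φ) : BddMeas fun x => f (φ x) :=
  ⟨hf.measurable.comp hφ, hf.bdd.imp fun _ h _ => h _⟩

lemma of_mem_Icc (hf : Measurable f) (h : ∀ x, f x ∈ Set.Icc (0 : ℝ) 1) : BddMeas f :=
  ⟨hf, 1, fun x => abs_le_one_of_mem (h x)⟩

lemma prod {ι : Type*} {s : Finset ι} {f : ι → α → ℝ} (hf : ∀ i ∈ s, BddMeas (f i)) :
    BddMeas fun x => ∏ i ∈ s, f i x := by
  induction s using Finset.induction_on with
  | empty => simpa using const 1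
  | insert i s hi ih =>
    simp only [Finset.prod_insert hi]
    exact (hf _ (by simp)).mul (ih fun j hj => hf j (by simp [hj]))

lemma integrable (hf : BddMeas f) (μ : Measure α) [IsFiniteMeasure μ] : Integrable f μ := by
  obtain ⟨C, hC⟩ := hf.bdd
  exact .of_bound hf.measurable.aestronglyMeasurable C (.of_forall hC)

lemma integral {f : α × β → ℝ} (hf : BddMeas f) (μ : Measure β) [IsProbabilityMeasure μ] :
    BddMeas fun x => ∫ y, f (x, y) ∂μ := by
  obtain ⟨C, hC⟩ := hf.bdd
  refine ⟨hf.measurable.stronglyMeasurable.integral_prod_right'.measurable, C, fun x => ?_⟩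
  simpa using norm_integral_le_of_norm_le_const (μ := μ) (f := fun y => f (x, y))
    (.of_forall fun y => hC (x, y))

end BddMeas

section Conditioning

variable {Ω Ω' : Type*} [MeasurableSpace Ω] [MeasurableSpace Ω'] (P : Measure Ω)
  [IsProbabilityMeasure P]

/-- Conditional expectation as a function of the conditioning variable. -/
lemma exists_integral_mul_eq {M : Ω → Ω'} (hM : Measurable M) {Y : Ω → ℝ} (hYm : Measurable Y)
    {a b : ℝ} (hY : ∀ ω, Y ω ∈ Set.Icc a b) :
    ∃ y : Ω' → ℝ, Measurable y ∧ (∀ x, y x ∈ Set.Icc a b) ∧ ∀ H : Ω' → ℝ, BddMeas H →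
      ∫ ω, Y ω * H (M ω) ∂P = ∫ ω, y (M ω) * H (M ω) ∂P := by
  have hYb : BddMeas Y := ⟨hYm, max |a| |b|, fun ω => abs_le_max_abs_abs (hY ω).1 (hY ω).2⟩
  have hab : a ≤ b := by
    obtain ⟨ω⟩ := P.nonempty_of_neZero
    exact (hY ω).1.trans (hY ω).2
  obtain ⟨h, hh, he⟩ := (stronglyMeasurable_condExp
    (m := MeasurableSpace.comap M inferInstance) (μ := P) (f := Y)).exists_eq_measurable_comp
  refine ⟨fun x => max a (min b (h x)), by have := hh.measurable; fun_prop,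
    fun x => ⟨le_max_left _ _, max_le hab (min_le_left _ _)⟩, fun H hH => ?_⟩
  have hHM : StronglyMeasurable[MeasurableSpace.comap M inferInstance] fun ω => H (M ω) :=
    (hH.measurable.comp (comap_measurable M)).stronglyMeasurable
  have hint : Integrable (Y * fun ω => H (M ω)) P := (hYb.mul (hH.comp hM)).integrable P
  have h1 := condExp_mul_of_stronglyMeasurable_right hHM hint (hYb.integrable P)
  have hlo : ∀ᵐ ω ∂P, a ≤ h (M ω) := by
    have := condExp_mono (m := MeasurableSpace.comap M inferInstance) (μ := P)
      (integrable_const a) (hYb.integrable P) (.of_forall fun ω => (hY ω).1)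
    rw [condExp_const hM.comap_le, he] at this
    exact this
  have hhi : ∀ᵐ ω ∂P, h (M ω) ≤ b := by
    have := condExp_mono (m := MeasurableSpace.comap M inferInstance) (μ := P)
      (hYb.integrable P) (integrable_const b) (.of_forall fun ω => (hY ω).2)
    rw [condExp_const hM.comap_le, he] at this
    exact this
  change ∫ ω, (Y * fun ω => H (M ω)) ω ∂P = _
  rw [← integral_condExp hM.comap_le]
  refine integral_congr_ae ?_
  filter_upwards [h1, hlo, hhi] with ω h1 hlo hhi
  rw [h1, he]
  simp [hlo, hhi]

lemma exists_bddMeas_integral_mul_eq {M : Ω → Ω'} (hM : Measurable M) {Y : Ω → ℝ}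
    (hY : BddMeas Y) :
    ∃ y : Ω' → ℝ, BddMeas y ∧ ∀ H : Ω' → ℝ, BddMeas H →
      ∫ ω, Y ω * H (M ω) ∂P = ∫ ω, y (M ω) * H (M ω) ∂P := by
  obtain ⟨C, hC⟩ := hY.bdd
  obtain ⟨y, hy, hyC, h⟩ := exists_integral_mul_eq P hM hY.measurable (a := -C) (b := C)
    fun ω => abs_le.1 (hC ω)
  exact ⟨y, ⟨hy, C, fun x => abs_le.2 (hyC x)⟩, h⟩

variable {P} {T M : Ω → Ω} {Y y : Ω → ℝ}

/-- If `T` preserves `P` and the function `Y`, and `M ∘ T` carries less information than `M`, then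
conditioning `Y` on `M ∘ T` is the same as conditioning it on `M`. -/
lemma integral_mul_eq_of_map_eq (hT : Measurable T) (hPT : P.map T = P) (hM : Measurable M)
    (hMT : ∀ ω, M (T (M ω)) = M (T ω)) (hY : BddMeas Y) (hYT : ∀ ω, Y (T ω) = Y ω)
    (hy : BddMeas y)
    (hYy : ∀ H, BddMeas H → ∫ ω, Y ω * H (M ω) ∂P = ∫ ω, y (M ω) * H (M ω) ∂P)
    {H : Ω → ℝ} (hH : BddMeas H) (hHM : ∀ ω, H (M ω) = H ω) :
    ∫ ω, Y ω * H ω ∂P = ∫ ω, y (M (T ω)) * H ω ∂P := by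
  have hmap {f : Ω → ℝ} (hf : BddMeas f) : ∫ ω, f (T ω) ∂P = ∫ ω, f ω ∂P := by
    conv_rhs => rw [← hPT]
    rw [integral_map hT.aemeasurable hf.measurable.aestronglyMeasurable]
  have hyM := hy.comp hM
  have hyMT := hyM.comp hT
  have hcross : ∫ ω, y (M ω) * y (M (T ω)) ∂P = ∫ ω, y (M ω) * y (M ω) ∂P := by
    have h1 := hYy _ hyMT
    simp only [hMT] at h1
    rw [← h1, ← hYy y hy, ← hmap (hY.mul hyM)]
    simp only [hYT]
  have hsq : ∫ ω, (y (M ω) - y (M (T ω))) * (y (M ω) - y (M (T ω))) ∂P = 0 := by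
    have h2 := hmap (hyM.mul hyM)
    have h3 : ∀ ω, (y (M ω) - y (M (T ω))) * (y (M ω) - y (M (T ω))) =
        (y (M ω) * y (M ω) - 2 * (y (M ω) * y (M (T ω)))) + y (M (T ω)) * y (M (T ω)) :=
      fun ω => by ring
    simp only [h3]
    have i1 : Integrable (fun ω => y (M ω) * y (M ω) - 2 * (y (M ω) * y (M (T ω)))) P :=
      ((hyM.mul hyM).integrable P).sub (((hyM.mul hyMT).integrable P).const_mul 2)
    rw [integral_add i1 ((hyMT.mul hyMT).integrable P),
      integral_sub ((hyM.mul hyM).integrable P) (((hyM.mul hyMT).integrable P).const_mul 2),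
      integral_const_mul, hcross, h2]
    ring
  rw [integral_eq_zero_iff_of_nonneg (fun _ => mul_self_nonneg _)
    (((hyM.sub hyMT).mul (hyM.sub hyMT)).integrable P)] at hsq
  have h := hYy H hH
  simp only [hHM] at h
  rw [h]
  refine integral_congr_ae ?_
  filter_upwards [hsq] with ω hω
  rw [sub_eq_zero.1 (mul_self_eq_zero.1 hω)]

lemma ae_eq_of_integral_mul_eq {M : Ω → Ω'} (hM : Measurable M) {f g : Ω' → ℝ} (hf : BddMeas f)
    (hg : BddMeas g)
    (h : ∀ H, BddMeas H → ∫ ω, f (M ω) * H (M ω) ∂P = ∫ ω, g (M ω) * H (M ω) ∂P) :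
    ∀ᵐ ω ∂P, f (M ω) = g (M ω) := by
  have hfg := hf.sub hg
  have h0 : ∫ ω, (f (M ω) - g (M ω)) * (f (M ω) - g (M ω)) ∂P = 0 := by
    have h1 := h _ hfg
    rw [← sub_eq_zero, ← integral_sub (((hf.mul hfg).comp hM).integrable P)
      (((hg.mul hfg).comp hM).integrable P)] at h1
    simpa only [sub_mul] using h1
  rw [integral_eq_zero_iff_of_nonneg (fun _ => mul_self_nonneg _)
    (((hfg.mul hfg).comp hM).integrable P)] at h0
  filter_upwards [h0] with ω hω
  exact sub_eq_zero.1 (mul_self_eq_zero.1 hω)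

end Conditioning

/-! ### Conditional independence in a sample-like array -/

lemma relabel_erasePair {σ : Vtx → Vtx} (hσ : Function.Injective σ) (i j : Vtx) (ω : Arr) :
    relabel σ (erasePair (σ i) (σ j) ω) = erasePair i j (relabel σ ω) := by
  simp only [relabel, erasePair, erase, Set.mem_ofPred_eq, hσ.eq_iff]
  simp only [Set.mem_empty_iff_false, if_false, Prod.mk.injEq, true_and]
  funext u v
  congr

lemma erasePair_erasePair (i j : Vtx) (ω : Arr) :
    erasePair i j (erasePair i j ω) = erasePair i j ω := by
  simp only [erasePair, erase, Prod.mk.injEq]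
  constructor
  · simp
  · funext u v; split_ifs <;> rfl

/-- A permutation of the base vertices which maps `0` to `i` and `1` to `j`. -/
def pairPerm (i j : ℕ) : Equiv.Perm ℕ := Equiv.swap (Equiv.swap 0 i 1) j * Equiv.swap 0 i

/-- The permutation of `Vtx` induced by a permutation of the base vertices. -/
def basePerm (σ : Equiv.Perm ℕ) : Equiv.Perm Vtx := Equiv.sumCongr σ (Equiv.refl _)

@[simp]
lemma basePerm_inl (σ : Equiv.Perm ℕ) (n : ℕ) : basePerm σ (.inl n) = .inl (σ n) := rfl

@[simp]
lemma basePerm_inr (σ : Equiv.Perm ℕ) (v : ℕ ⊕ ℕ) : basePerm σ (.inr v) = .inr v := rfl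

lemma pairPerm_one (i j : ℕ) : pairPerm i j 1 = j := by
  simp [pairPerm]

lemma pairPerm_zero {i j : ℕ} (h : i ≠ j) : pairPerm i j 0 = i := by
  rw [pairPerm, Equiv.Perm.mul_apply, Equiv.swap_apply_left]
  refine Equiv.swap_apply_of_ne_of_ne (fun h' => ?_) h
  have := (Equiv.swap 0 i).injective ((Equiv.swap_apply_left 0 i).trans h')
  omega

/-- Put the base vertices `i` and `j` first, and reference vertices everywhere else. -/
def pairEmb (i j : ℕ) (v : Vtx) : Vtx :=
  if v = .inl 0 then .inl i else if v = .inl 1 then .inl j else .inr (.inl (Encodable.encode v))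

lemma basePerm_pairEmb {i j : ℕ} (h : i ≠ j) (v : Vtx) :
    basePerm (pairPerm i j) (pairEmb 0 1 v) = pairEmb i j v := by
  unfold pairEmb
  split_ifs <;> simp [pairPerm_one, pairPerm_zero h]

lemma pairEmb_injective : Function.Injective (pairEmb 0 1) := by
  intro u v h
  unfold pairEmb at h
  split_ifs at h <;> simp_all

lemma IsSampleLike.integral_relabel {P : Measure Arr} (hP : IsSampleLike P) {σ : Vtx → Vtx}
    (hσ : Function.Injective σ) {f : Arr → ℝ} (hf : BddMeas f) :
    ∫ ω, f (relabel σ ω) ∂P = ∫ ω, f ω ∂P := by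
  conv_rhs => rw [← hP.map_relabel σ hσ]
  rw [integral_map (by fun_prop) hf.measurable.aestronglyMeasurable]

lemma BddMeas.weight (u v : Vtx) : BddMeas fun ω : Arr => (ω.2 u v : ℝ) :=
  .of_mem_Icc (by fun_prop) fun _ => Subtype.property _

/-- Given everything else, the conditional mean of the weight of a pair of base vertices depends
only on these two vertices and the reference vertices, by a universal formula. -/
lemma IsSampleLike.exists_edge {P : Measure Arr} [IsProbabilityMeasure P] (hP : IsSampleLike P) :
    ∃ w : Arr → ℝ, Measurable w ∧ (∀ ω, w ω ∈ Set.Icc (0 : ℝ) 1) ∧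
      (∀ ω, w (erasePair (.inl 0) (.inl 1) ω) = w ω) ∧
      ∀ i j : ℕ, i ≠ j → ∀ H, BddMeas H → (∀ ω, H (erasePair (.inl i) (.inl j) ω) = H ω) →
        ∫ ω, (ω.2 (.inl i) (.inl j) : ℝ) * H ω ∂P =
          ∫ ω, w (relabel (pairEmb i j) ω) * H ω ∂P := by
  set M : Arr → Arr := erasePair (.inl 0) (.inl 1) with hM
  have hMm : Measurable M := by fun_prop
  obtain ⟨y, hym, hy01, hy⟩ := exists_integral_mul_eq P hMm
    (Y := fun ω => (ω.2 (.inl 0) (.inl 1) : ℝ)) (by fun_prop) (a := 0) (b := 1)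
    fun ω => Subtype.property _
  have h01 : ∀ H, BddMeas H → (∀ ω, H (M ω) = H ω) →
      ∫ ω, (ω.2 (.inl 0) (.inl 1) : ℝ) * H ω ∂P =
        ∫ ω, y (M (relabel (pairEmb 0 1) ω)) * H ω ∂P := by
    intro H hH hHM
    refine integral_mul_eq_of_map_eq (by fun_prop) (hP.map_relabel _ pairEmb_injective) hMm
      (fun ω => ?_) (.weight _ _) (fun ω => ?_) (.of_mem_Icc hym hy01) hy hH hHM
    · have := relabel_erasePair pairEmb_injective (.inl 0) (.inl 1) ω
      simp only [pairEmb, if_true, reduceCtorEq, Sum.inl.injEq, one_ne_zero, if_false] at this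
      rw [hM, this, erasePair_erasePair]
    · simp [relabel, pairEmb]
  refine ⟨fun ω => y (M ω), hym.comp hMm, fun ω => hy01 _, fun ω => by
    simp only [hM, erasePair_erasePair], fun i j hij H hH hHij => ?_⟩
  set ρ := basePerm (pairPerm i j) with hρ
  have hρ0 : ρ.symm (.inl i) = .inl 0 := by
    rw [Equiv.symm_apply_eq]; simp [hρ, pairPerm_zero hij]
  have hρ1 : ρ.symm (.inl j) = .inl 1 := by
    rw [Equiv.symm_apply_eq]; simp [hρ, pairPerm_one]
  have hinv : ∀ ω, relabel ρ.symm (relabel ρ ω) = ω := fun ω => by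
    simp [relabel]
  have hH' : BddMeas fun ω => H (relabel ρ.symm ω) := hH.comp (by fun_prop)
  have key := h01 _ hH' fun ω => by
    have := relabel_erasePair ρ.symm.injective (.inl i) (.inl j) ω
    rw [hρ0, hρ1] at this
    rw [hM, this, hHij]
  rw [← hP.integral_relabel ρ.injective ((BddMeas.weight _ _).mul hH'),
    ← hP.integral_relabel ρ.injective (((BddMeas.of_mem_Icc hym hy01).comp
      (φ := fun ω => M (relabel (pairEmb 0 1) ω)) (by fun_prop)).mul hH')] at key
  simp only [hinv] at key
  convert key using 4 with ω
  · simp [relabel, hρ, pairPerm_zero hij, pairPerm_one]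
  · simp only [relabel, hρ, basePerm_pairEmb hij]

/-- A point with its label and its weights to and from the reference vertices. -/
abbrev Pt : Type := UI × (ℕ → UI × UI)

/-- The label of a base vertex together with its weights to and from the reference vertices. -/
def ptAt (i : ℕ) (ω : Arr) : Pt :=
  (ω.1 (.inl i), fun b => (ω.2 (.inl i) (.inr (.inl b)), ω.2 (.inr (.inl b)) (.inl i)))

@[fun_prop]
lemma measurable_ptAt (i : ℕ) : Measurable (ptAt i) := by
  unfold ptAt; fun_prop

lemma IsSampleLike.map_erasePts_label {P : Measure Arr} [IsProbabilityMeasure P]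
    (hP : IsSampleLike P) (i : ℕ) :
    P.map (fun ω => (erasePts base ω, ω.1 (.inl i))) =
      (P.map (erasePts base)).prod (volume : Measure UI) := by
  have hlab : P.map (fun ω : Arr => ω.1 (.inl i)) = (volume : Measure UI) := by
    rw [← Measure.infinitePi_map_eval (fun _ : Vtx => (volume : Measure UI)) (.inl i),
      ← hP.map_label, Measure.map_map (by fun_prop) (by fun_prop)]
    rfl
  have h := ((indepFun_iff_map_prod_eq_prod_map_map (by fun_prop) (by fun_prop)).2 hP.indep).comp
    (φ := fun ω : Arr => ω.1 (.inl i)) (ψ := id) (by fun_prop) measurable_id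
  have h1 : (fun ω : Arr => ω.1 (.inl i)) ∘ erasePts baseᶜ = fun ω => ω.1 (.inl i) := by
    funext ω; simp [erasePts, erase, base]
  rw [h1, Function.id_comp] at h
  rw [(indepFun_iff_map_prod_eq_prod_map_map (by fun_prop) (by fun_prop)).1 h.symm, hlab]

/-- The base vertex `0` is obtained from a uniformly random point of the unit square and the
information about the other vertices by a measurable function. -/
lemma IsSampleLike.exists_point_zero {P : Measure Arr} [IsProbabilityMeasure P]
    (hP : IsSampleLike P) :
    ∃ R : Arr → USq → Pt, Measurable (Function.uncurry R) ∧ (∀ a v, (R a v).1 = v.1) ∧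
      ∀ g, BddMeas g → ∀ h, BddMeas h →
        ∫ ω, g (ptAt 0 ω) * h (erasePts base ω) ∂P =
          ∫ ω, (∫ v, g (R (erasePts base ω) v)) * h (erasePts base ω) ∂P := by
  set X : Arr → Arr × UI := fun ω => (erasePts base ω, ω.1 (.inl 0)) with hX
  set η : Arr → ℕ → UI × UI := fun ω => (ptAt 0 ω).2 with hη
  have hXm : Measurable X := by fun_prop
  have hηm : Measurable η := by fun_prop
  obtain ⟨r, hr, hrκ⟩ := (condDistrib η X P).exists_measurable_map_eq_unitInterval
  have hR : Measurable (Function.uncurry fun (a : Arr) (v : USq) =>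
      ((v.1, r (a, v.1) v.2) : Pt)) := by
    refine .prodMk (by fun_prop) ?_
    exact hr.comp (by fun_prop : Measurable fun p : Arr × USq => ((p.1, p.2.1), p.2.2))
  refine ⟨fun a v => (v.1, r (a, v.1) v.2), hR, fun _ _ => rfl, fun g hg h hh => ?_⟩
  have hf : BddMeas fun p : (Arr × UI) × (ℕ → UI × UI) => g (p.1.2, p.2) * h p.1.1 :=
    (hg.comp (by fun_prop)).mul (hh.comp (by fun_prop))
  have hfR : BddMeas fun p : Arr × USq => g (p.2.1, r (p.1, p.2.1) p.2.2) * h p.1 :=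
    (hg.comp hR).mul (hh.comp (by fun_prop))
  calc ∫ ω, g (ptAt 0 ω) * h (erasePts base ω) ∂P
      = ∫ p, g (p.1.2, p.2) * h p.1.1 ∂(P.map fun ω => (X ω, η ω)) := by
        rw [integral_map (by fun_prop) hf.measurable.aestronglyMeasurable]
        rfl
    _ = ∫ q, (∫ e, g (q.2, e) * h q.1 ∂(condDistrib η X P q)) ∂(P.map X) := by
        have : IsProbabilityMeasure (P.map X) := Measure.isProbabilityMeasure_map (by fun_prop)
        rw [← compProd_map_condDistrib hηm.aemeasurable,
          Measure.integral_compProd (hf.integrable _)]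
    _ = ∫ q, (∫ y, g (q.2, r q y) * h q.1) ∂(P.map X) := by
        refine integral_congr_ae (.of_forall fun q => ?_)
        have hrq : Measurable (r q) := hr.comp measurable_prodMk_left
        simp only
        rw [← hrκ q, integral_map hrq.aemeasurable]
        exact (hf.comp (measurable_prodMk_left (x := q))).measurable.aestronglyMeasurable
    _ = ∫ a, (∫ v : USq, g (v.1, r (a, v.1) v.2) * h a) ∂(P.map (erasePts base)) := by
        have : IsProbabilityMeasure (P.map (erasePts base)) :=
          Measure.isProbabilityMeasure_map (by fun_prop)
        have hq : BddMeas fun q : Arr × UI => ∫ y : UI, g (q.2, r q y) * h q.1 :=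
          (hfR.comp (φ := fun p : (Arr × UI) × UI => (p.1.1, (p.1.2, p.2))) (by fun_prop)).integral
            volume
        rw [hX, hP.map_erasePts_label, integral_prod _ (hq.integrable _)]
        refine integral_congr_ae (.of_forall fun a => ?_)
        exact (integral_prod _ ((hfR.comp (measurable_prodMk_left (x := a))).integrable _)).symm
    _ = _ := by
        rw [integral_map (by fun_prop) (hfR.integral volume).measurable.aestronglyMeasurable]
        simp only [integral_mul_const]

/-- Move the base vertices other than `0` to reference vertices. -/
def shiftEmb : Vtx → Vtx
  | .inl n => if n = 0 then .inl 0 else .inr (.inr (2 * n))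
  | .inr (.inl b) => .inr (.inl b)
  | .inr (.inr c) => .inr (.inr (2 * c + 1))

lemma shiftEmb_injective : Function.Injective shiftEmb := by
  rintro (m | b | c) (n | b' | c') h <;> simp only [shiftEmb] at h <;> (try split_ifs at h) <;>
    simp_all <;> omega

lemma erasePts_congr {N : Set Vtx} {ω ω' : Arr} (h1 : ∀ v, v ∉ N → ω.1 v = ω'.1 v)
    (h2 : ∀ u v, u ∉ N → v ∉ N → ω.2 u v = ω'.2 u v) : erasePts N ω = erasePts N ω' := by
  refine Prod.ext (funext fun v => ?_) (funext fun u => funext fun v => ?_)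
  · by_cases hv : v ∈ N <;> simp [erasePts, erase, hv, h1]
  · by_cases hu : u ∈ N <;> by_cases hv : v ∈ N <;> simp [erasePts, erase, hu, hv, h2]

lemma erasePts_fst {N : Set Vtx} {v : Vtx} (hv : v ∉ N) (ω : Arr) :
    (erasePts N ω).1 v = ω.1 v := by simp [erasePts, erase, hv]

lemma erasePts_snd {N : Set Vtx} {u v : Vtx} (hu : u ∉ N) (hv : v ∉ N) (ω : Arr) :
    (erasePts N ω).2 u v = ω.2 u v := by simp [erasePts, erase, hu, hv]

lemma inr_notMem_base (v : ℕ ⊕ ℕ) : (.inr v : Vtx) ∉ base := by simp [base]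

/-- Erasing the base does not affect what `shiftEmb` sees outside of vertex `0`. -/
lemma erasePts_relabel_shiftEmb {ω ω' : Arr} (h1 : ∀ v, ω.1 (.inr v) = ω'.1 (.inr v))
    (h2 : ∀ u v, ω.2 (.inr u) (.inr v) = ω'.2 (.inr u) (.inr v)) :
    erasePts {.inl 0} (relabel shiftEmb ω) = erasePts {.inl 0} (relabel shiftEmb ω') := by
  have h : ∀ v : Vtx, v ∉ ({.inl 0} : Set Vtx) → ∃ v', shiftEmb v = .inr v' := by
    rintro (n | b | c) hv
    · exact ⟨_, if_neg fun h => hv (by simp [h])⟩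
    · exact ⟨_, rfl⟩
    · exact ⟨_, rfl⟩
  refine erasePts_congr (fun v hv => ?_) fun u v hu hv => ?_
  · obtain ⟨v', hv'⟩ := h v hv
    simp [relabel, hv', h1]
  · obtain ⟨u', hu'⟩ := h u hu
    obtain ⟨v', hv'⟩ := h v hv
    simp [relabel, hu', hv', h2]

lemma relabel_erasePts {σ : Vtx → Vtx} {M N : Set Vtx} (h : ∀ v, σ v ∈ N ↔ v ∈ M) (ω : Arr) :
    relabel σ (erasePts N ω) = erasePts M (relabel σ ω) := by
  refine Prod.ext (funext fun v => ?_) (funext fun u => funext fun v => ?_)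
  · simp [relabel, erasePts, erase, h]
  · simp [relabel, erasePts, erase, h]

/-- `R` produces a base vertex from the reference vertices and a uniformly random point of the
unit square: given everything else, a base vertex is distributed as if only the reference vertices
were given, and its conditional law is described by `R`. -/
structure IsPointKernel (P : Measure Arr) (R : Arr → USq → Pt) : Prop where
  measurable : Measurable (Function.uncurry R)
  fst_eq : ∀ a v, (R a v).1 = v.1
  integral_mul : ∀ (i : ℕ) g H, BddMeas g → BddMeas H → (∀ ω, H (erasePts {.inl i} ω) = H ω) →
    ∫ ω, g (ptAt i ω) * H ω ∂P = ∫ ω, (∫ v, g (R (erasePts base ω) v)) * H ω ∂P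

lemma IsSampleLike.exists_isPointKernel {P : Measure Arr} [IsProbabilityMeasure P]
    (hP : IsSampleLike P) : ∃ R, IsPointKernel P R := by
  obtain ⟨R, hR, hR1, h0⟩ := hP.exists_point_zero
  refine ⟨R, hR, hR1, ?_⟩
  have hG {g : Pt → ℝ} (hg : BddMeas g) : BddMeas fun a => ∫ v, g (R a v) :=
    (hg.comp hR).integral volume
  have hz : ∀ g H, BddMeas g → BddMeas H → (∀ ω, H (erasePts {.inl 0} ω) = H ω) →
      ∫ ω, g (ptAt 0 ω) * H ω ∂P = ∫ ω, (∫ v, g (R (erasePts base ω) v)) * H ω ∂P := by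
    intro g H hg hH hHM
    have hM : Measurable (erasePts {.inl 0}) := measurable_erasePts _
    obtain ⟨y, hy, hyY⟩ := exists_bddMeas_integral_mul_eq P hM
      (hg.comp (measurable_ptAt 0))
    have hT {H : Arr → ℝ} (hH : BddMeas H) (hHM : ∀ ω, H (erasePts {.inl 0} ω) = H ω) :
        ∫ ω, g (ptAt 0 ω) * H ω ∂P =
          ∫ ω, y (erasePts {.inl 0} (relabel shiftEmb ω)) * H ω ∂P :=
      integral_mul_eq_of_map_eq (by fun_prop) (hP.map_relabel _ shiftEmb_injective) hM
        (fun ω => erasePts_relabel_shiftEmb (fun v => erasePts_fst (by simp) ω)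
          fun u v => erasePts_snd (by simp) (by simp) ω)
        (hg.comp (measurable_ptAt 0)) (fun ω => rfl) hy hyY hH hHM
    have hα : ∀ ω, erasePts {.inl 0} (relabel shiftEmb (erasePts base ω)) =
        erasePts {.inl 0} (relabel shiftEmb ω) := fun ω =>
      erasePts_relabel_shiftEmb (fun v => erasePts_fst (inr_notMem_base v) ω)
        fun u v => erasePts_snd (inr_notMem_base u) (inr_notMem_base v) ω
    have hae := ae_eq_of_integral_mul_eq (P := P) (measurable_erasePts base)
      (hy.comp (φ := fun a => erasePts {.inl 0} (relabel shiftEmb a)) (by fun_prop)) (hG hg)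
      fun h hh => by
        rw [← h0 g hg h hh, hT (hh.comp (measurable_erasePts base)) fun ω => ?_]
        · simp only [hα]
        · congr 1
          exact erasePts_congr
            (fun v hv => erasePts_fst (fun h => hv (by rw [h]; exact ⟨0, rfl⟩)) ω)
            fun u v hu hv => erasePts_snd (fun h => hu (by rw [h]; exact ⟨0, rfl⟩))
              (fun h => hv (by rw [h]; exact ⟨0, rfl⟩)) ω
    rw [hT hH hHM]
    refine integral_congr_ae ?_
    filter_upwards [hae] with ω hω
    rw [← hω, hα]
  intro i g H hg hH hHi
  set ρ := basePerm (Equiv.swap 0 i) with hρ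
  have hinv : ∀ ω, relabel ρ (relabel ρ ω) = ω := fun ω => by
    refine Prod.ext (funext fun v => ?_) (funext fun u => funext fun v => ?_)
    · rcases v with n | v <;> simp [relabel, hρ]
    · rcases u with m | u <;> rcases v with n | v <;> simp [relabel, hρ]
  have hH' : BddMeas fun ω => H (relabel ρ ω) := hH.comp (by fun_prop)
  have key := hz g _ hg hH' fun ω => by
    rw [relabel_erasePts (M := {.inl i}), hHi]
    rintro (n | v)
    · simp [hρ, Equiv.swap_apply_eq_iff]
    · simp [hρ]
  rw [← hP.integral_relabel ρ.injective ((hg.comp (measurable_ptAt 0)).mul hH'),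
    ← hP.integral_relabel ρ.injective
      (((hG hg).comp (measurable_erasePts base)).mul hH')] at key
  simp only [hinv] at key
  convert key using 4 with ω
  · simp [ptAt, relabel, hρ]
  · rename_i ω
    congr! 4
    refine erasePts_congr ?_ ?_
    · rintro (n | v) hv
      · exact absurd ⟨n, rfl⟩ hv
      · simp [relabel, hρ]
    · rintro (m | u) (n | v) hu hv
      · exact absurd ⟨m, rfl⟩ hu
      · exact absurd ⟨m, rfl⟩ hu
      · exact absurd ⟨n, rfl⟩ hv
      · simp [relabel, hρ]

/-- The array consisting of two base vertices and the reference vertices, without the weights of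
pairs of base vertices. -/
def pairArr (a : Arr) (p q : Pt) : Arr :=
  (fun v => if v = .inl 0 then p.1 else if v = .inl 1 then q.1
    else a.1 (.inr (.inl (Encodable.encode v))),
  fun u v =>
    if u = .inl 0 then
      if v = .inl 0 then 0 else if v = .inl 1 then 0 else (p.2 (Encodable.encode v)).1
    else if u = .inl 1 then
      if v = .inl 0 then 0 else if v = .inl 1 then 0 else (q.2 (Encodable.encode v)).1
    else if v = .inl 0 then (p.2 (Encodable.encode u)).2
    else if v = .inl 1 then (q.2 (Encodable.encode u)).2
    else a.2 (.inr (.inl (Encodable.encode u))) (.inr (.inl (Encodable.encode v))))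

lemma measurable_pairArr : Measurable fun x : Arr × Pt × Pt => pairArr x.1 x.2.1 x.2.2 := by
  unfold pairArr
  refine .prodMk (measurable_pi_lambda _ fun v => ?_)
    (measurable_pi_lambda _ fun u => measurable_pi_lambda _ fun v => ?_)
  · split_ifs <;> fun_prop
  · split_ifs <;> fun_prop

lemma erasePair_relabel_pairEmb (i j : ℕ) (ω : Arr) :
    erasePair (.inl 0) (.inl 1) (relabel (pairEmb i j) ω) =
      pairArr (erasePts base ω) (ptAt i ω) (ptAt j ω) := by
  have h1 (v) := erasePts_fst (inr_notMem_base v) ω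
  have h2 (u v) := erasePts_snd (inr_notMem_base u) (inr_notMem_base v) ω
  refine Prod.ext (funext fun v => ?_) (funext fun u => funext fun v => ?_)
  · simp only [pairArr, erasePair, erase, relabel, pairEmb, ptAt, h1]
    split_ifs <;> simp_all
  · simp only [pairArr, erasePair, erase, relabel, pairEmb, ptAt, h2]
    split_ifs <;> simp_all

lemma erasePair_comm (i j : Vtx) : erasePair i j = erasePair j i := by
  simp only [erasePair, or_comm]

/-- `w` gives the conditional mean of the weight of a pair of base vertices, given everything
else, in terms of the two vertices and the reference vertices. -/
structure IsEdgeKernel (P : Measure Arr) (w : Arr → Pt → Pt → ℝ) : Prop where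
  measurable : Measurable fun x : Arr × Pt × Pt => w x.1 x.2.1 x.2.2
  mem_Icc : ∀ a p q, w a p q ∈ Set.Icc (0 : ℝ) 1
  symm : ∀ a p q, w a p q = w a q p
  integral_mul : ∀ i j : ℕ, i ≠ j → ∀ H, BddMeas H →
    (∀ ω, H (erasePair (.inl i) (.inl j) ω) = H ω) →
      ∫ ω, (ω.2 (.inl i) (.inl j) : ℝ) * H ω ∂P =
        ∫ ω, w (erasePts base ω) (ptAt i ω) (ptAt j ω) * H ω ∂P

lemma IsSampleLike.exists_isEdgeKernel {P : Measure Arr} [IsProbabilityMeasure P]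
    (hP : IsSampleLike P) : ∃ w, IsEdgeKernel P w := by
  obtain ⟨w, hw, hw01, hwe, hint⟩ := hP.exists_edge
  have hwm := hw.comp measurable_pairArr
  refine ⟨fun a p q => (w (pairArr a p q) + w (pairArr a q p)) / 2, ?_, fun a p q => ?_,
    fun a p q => congrArg (· / 2) (add_comm _ _), fun i j hij H hH hHij => ?_⟩
  · exact (hwm.add (hwm.comp (by fun_prop : Measurable fun x : Arr × Pt × Pt =>
      (x.1, x.2.2, x.2.1)))).div_const 2
  · have h1 := hw01 (pairArr a p q)
    have h2 := hw01 (pairArr a q p)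
    constructor <;> linarith [h1.1, h1.2, h2.1, h2.2]
  · have hb (i j : ℕ) : BddMeas fun ω => w (pairArr (erasePts base ω) (ptAt i ω) (ptAt j ω)) :=
      .of_mem_Icc (hwm.comp (by fun_prop : Measurable fun ω =>
        (erasePts base ω, ptAt i ω, ptAt j ω))) fun _ => hw01 _
    have h1 := hint i j hij H hH hHij
    have h2 := hint j i hij.symm H hH (by rwa [erasePair_comm])
    have hsymm : ∫ ω, (ω.2 (.inl i) (.inl j) : ℝ) * H ω ∂P =
        ∫ ω, (ω.2 (.inl j) (.inl i) : ℝ) * H ω ∂P := by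
      refine integral_congr_ae ?_
      filter_upwards [hP.symm (.inl i) (.inl j)] with ω hω
      rw [hω]
    simp only [← hwe (relabel _ _), erasePair_relabel_pairEmb] at h1 h2
    rw [← hsymm] at h2
    simp only [add_div, add_mul, div_mul_eq_mul_div]
    rw [integral_add (((hb i j).mul hH).integrable P |>.div_const 2)
      (((hb j i).mul hH).integrable P |>.div_const 2), integral_div, integral_div, ← h1, ← h2]
    ring

/-! ### Representation of a sample-like array by an orderon -/

section Representation

variable {P : Measure Arr} [IsProbabilityMeasure P]

lemma ptAt_erasePair (l i j : ℕ) (ω : Arr) : ptAt l (erasePair (.inl i) (.inl j) ω) = ptAt l ω := by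
  simp [ptAt, erasePair, erase]

lemma ptAt_erasePts {l i : ℕ} (h : l ≠ i) (ω : Arr) : ptAt l (erasePts {.inl i} ω) = ptAt l ω := by
  simp [ptAt, erasePts, erase, h]

lemma erasePts_base_erasePair (i j : ℕ) (ω : Arr) :
    erasePts base (erasePair (.inl i) (.inl j) ω) = erasePts base ω := by
  refine erasePts_congr (fun v _ => by simp [erasePair, erase]) fun u v hu _ => ?_
  have h (i : ℕ) : u ≠ .inl i := fun h => hu ⟨i, h.symm⟩
  simp [erasePair, erase, h]

lemma erasePts_base_erasePts (i : ℕ) (ω : Arr) :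
    erasePts base (erasePts {.inl i} ω) = erasePts base ω := by
  have h {u : Vtx} (hu : u ∉ base) : u ∉ ({.inl i} : Set Vtx) := fun h => hu ⟨i, h.symm⟩
  exact erasePts_congr (fun v hv => erasePts_fst (h hv) ω)
    fun u v hu hv => erasePts_snd (h hu) (h hv) ω

section Edges

variable {w : Arr → Pt → Pt → ℝ} {k : ℕ} (F : SimpleGraph (Fin k))

lemma IsEdgeKernel.bddMeas_edgeFactor {P : Measure Arr} (hw : IsEdgeKernel P w)
    (p : Fin k × Fin k) :
    BddMeas fun x : Arr × Pt × Pt => edgeFactor F p (w x.1 x.2.1 x.2.2) :=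
  .of_mem_Icc ((measurable_edgeFactor F p).comp hw.measurable) fun _ =>
    edgeFactor_mem F p (hw.mem_Icc _ _ _)

lemma IsEdgeKernel.integral_edgeFactor_mul (hw : IsEdgeKernel P w) (p : Fin k × Fin k)
    (hp : p.1 < p.2) {H : Arr → ℝ} (hH : BddMeas H)
    (hHp : ∀ ω, H (erasePair (.inl p.1) (.inl p.2) ω) = H ω) :
    ∫ ω, edgeFactor F p (ω.2 (.inl p.1) (.inl p.2)) * H ω ∂P =
      ∫ ω, edgeFactor F p (w (erasePts base ω) (ptAt p.1 ω) (ptAt p.2 ω)) * H ω ∂P := by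
  have h := hw.integral_mul p.1 p.2 (by have := Fin.lt_def.1 hp; omega) H hH hHp
  have hb : BddMeas fun ω => w (erasePts base ω) (ptAt p.1 ω) (ptAt p.2 ω) :=
    .of_mem_Icc (hw.measurable.comp (by fun_prop : Measurable fun ω =>
      (erasePts base ω, ptAt p.1 ω, ptAt p.2 ω))) fun _ => hw.mem_Icc _ _ _
  unfold edgeFactor
  split_ifs
  · exact h
  · simp only [sub_mul, one_mul]
    rw [integral_sub (hH.integrable P) (((BddMeas.weight _ _).mul hH).integrable P),
      integral_sub (hH.integrable P) ((hb.mul hH).integrable P), h]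

lemma IsEdgeKernel.integral_prod_edgeFactor_mul (hw : IsEdgeKernel P w)
    (S : Finset (Fin k × Fin k)) (hS : ∀ p ∈ S, p.1 < p.2) {H : Arr → ℝ} (hH : BddMeas H)
    (hHp : ∀ (i j : ℕ) ω, H (erasePair (.inl i) (.inl j) ω) = H ω) :
    ∫ ω, (∏ p ∈ S, edgeFactor F p (ω.2 (.inl p.1) (.inl p.2))) * H ω ∂P =
      ∫ ω, (∏ p ∈ S, edgeFactor F p (w (erasePts base ω) (ptAt p.1 ω) (ptAt p.2 ω))) * H ω ∂P := by
  induction S using Finset.induction_on generalizing H with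
  | empty => rfl
  | insert p S hpS ih =>
    have hb : BddMeas fun ω => edgeFactor F p (w (erasePts base ω) (ptAt p.1 ω) (ptAt p.2 ω)) :=
      (hw.bddMeas_edgeFactor F p).comp (by fun_prop : Measurable fun ω =>
        (erasePts base ω, ptAt p.1 ω, ptAt p.2 ω))
    have hX : BddMeas fun ω : Arr => ∏ q ∈ S, edgeFactor F q (ω.2 (.inl q.1) (.inl q.2)) :=
      .prod fun q _ => .of_mem_Icc (by fun_prop) fun ω => edgeFactor_mem F q (Subtype.property _)
    have hSS : ∀ q ∈ S, q.1 < q.2 := fun q hq => hS q (Finset.mem_insert_of_mem hq)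
    have h1 := hw.integral_edgeFactor_mul F p (hS p (Finset.mem_insert_self _ _))
      (hX.mul hH) fun ω => by
        rw [hHp]
        congr 1
        refine Finset.prod_congr rfl fun q hq => ?_
        have hne : ¬(((Sum.inl q.1 : Vtx) = .inl p.1 ∨ (Sum.inl q.1 : Vtx) = .inl p.2) ∧
            ((Sum.inl q.2 : Vtx) = .inl p.1 ∨ (Sum.inl q.2 : Vtx) = .inl p.2)) := by
          have hlt := Fin.lt_def.1 (hSS q hq)
          have hlt' := Fin.lt_def.1 (hS p (Finset.mem_insert_self _ _))
          have hqp : ¬(q.1 = p.1 ∧ q.2 = p.2) := fun h => hpS (Prod.ext h.1 h.2 ▸ hq)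
          simp only [Sum.inl.injEq, Fin.ext_iff] at hqp ⊢
          omega
        simp only [erasePair, erase, Set.mem_ofPred_eq, if_neg hne]
    have h2 := ih hSS (hb.mul hH) fun i j ω => by
      simp only [ptAt_erasePair, erasePts_base_erasePair, hHp]
    simp only [Finset.prod_insert hpS, mul_assoc]
    rw [h1]
    simp only [mul_left_comm (edgeFactor F p _)]
    exact h2

end Edges

section Points

variable {R : Arr → USq → Pt}

lemma IsPointKernel.measurable_pi {P : Measure Arr} (hR : IsPointKernel P R) (k : ℕ) :
    Measurable fun x : Arr × (Fin k → USq) =>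
      ((fun i => R x.1 (x.2 i), x.1) : (Fin k → Pt) × Arr) :=
  .prodMk (measurable_pi_lambda _ fun i => hR.measurable.comp
    (by fun_prop : Measurable fun x : Arr × (Fin k → USq) => (x.1, x.2 i))) (by fun_prop)

lemma IsPointKernel.integral_prod_ptAt_mul {P : Measure Arr} (hR : IsPointKernel P R) {k : ℕ}
    (S : Finset (Fin k)) {g : Fin k → Pt → ℝ}
    (hg : ∀ i, BddMeas (g i)) {h : Arr → ℝ} (hh : BddMeas h) :
    ∫ ω, (∏ i ∈ S, g i (ptAt i ω)) * h (erasePts base ω) ∂P =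
      ∫ ω, (∏ i ∈ S, ∫ v, g i (R (erasePts base ω) v)) * h (erasePts base ω) ∂P := by
  induction S using Finset.induction_on generalizing h with
  | empty => rfl
  | insert i S hiS ih =>
    have hG : BddMeas fun a => ∫ v, g i (R a v) := ((hg i).comp hR.measurable).integral volume
    have h1 := hR.integral_mul i (g i)
      (fun ω => (∏ j ∈ S, g j (ptAt j ω)) * h (erasePts base ω)) (hg i)
      ((BddMeas.prod fun j _ => (hg j).comp (measurable_ptAt j)).mul
        (hh.comp (measurable_erasePts base))) fun ω => by
        simp only [erasePts_base_erasePts]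
        congr 1
        refine Finset.prod_congr rfl fun j hj => ?_
        have hji : (j : ℕ) ≠ i := fun h => hiS (by rwa [← Fin.ext h])
        rw [ptAt_erasePts hji]
    simp only [Finset.prod_insert hiS, mul_assoc]
    rw [h1]
    simp only [mul_left_comm (∫ v, g i (R _ v))]
    exact ih (hG.mul hh)

lemma IsPointKernel.map_ptAt_erasePts (hR : IsPointKernel P R) (k : ℕ) :
    P.map (fun ω => (fun i : Fin k => ptAt i ω, erasePts base ω)) =
      ((P.map (erasePts base)).prod (volume : Measure (Fin k → USq))).map
        fun x => (fun i => R x.1 (x.2 i), x.1) := by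
  have : IsProbabilityMeasure (P.map (erasePts base)) :=
    Measure.isProbabilityMeasure_map (by fun_prop)
  have hm := hR.measurable_pi k
  have hm' : Measurable fun ω => ((fun i : Fin k => ptAt i ω, erasePts base ω) :
      (Fin k → Pt) × Arr) := by fun_prop
  have : IsProbabilityMeasure (P.map fun ω => ((fun i : Fin k => ptAt i ω, erasePts base ω) :
      (Fin k → Pt) × Arr)) := Measure.isProbabilityMeasure_map hm'.aemeasurable
  have : IsProbabilityMeasure (((P.map (erasePts base)).prod
      (volume : Measure (Fin k → USq))).map fun x => ((fun i => R x.1 (x.2 i), x.1) :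
      (Fin k → Pt) × Arr)) := Measure.isProbabilityMeasure_map hm.aemeasurable
  refine Measure.ext_of_integral_prod_mul_boundedContinuousFunction fun f g => ?_
  have hb {α : Type} [TopologicalSpace α] [MeasurableSpace α] [OpensMeasurableSpace α]
      (f : α →ᵇ ℝ) : BddMeas f := ⟨f.continuous.measurable, ‖f‖, f.norm_coe_le_norm⟩
  have hfg : BddMeas fun p : (Fin k → Pt) × Arr => (∏ i, f i (p.1 i)) * g p.2 :=
    (BddMeas.prod fun i _ => (hb (f i)).comp (by fun_prop)).mul ((hb g).comp measurable_snd)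
  rw [integral_map hm'.aemeasurable hfg.measurable.aestronglyMeasurable,
    integral_map hm.aemeasurable hfg.measurable.aestronglyMeasurable,
    hR.integral_prod_ptAt_mul Finset.univ (fun i => hb (f i)) (hb g),
    integral_prod _ ((hfg.comp hm).integrable _),
    integral_map (by fun_prop) ((hfg.comp hm).integral volume).measurable.aestronglyMeasurable]
  refine integral_congr_ae (.of_forall fun ω => ?_)
  simp only [integral_mul_const]
  rw [volume_pi, integral_fintype_prod_eq_prod (fun i v => f i (R (erasePts base ω) v))]

lemma IsPointKernel.integral_ptAt_erasePts (hR : IsPointKernel P R) {k : ℕ}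
    {f : (Fin k → Pt) × Arr → ℝ} (hf : BddMeas f) :
    ∫ ω, f (fun i => ptAt i ω, erasePts base ω) ∂P =
      ∫ ω, (∫ v : Fin k → USq, f (fun i => R (erasePts base ω) (v i), erasePts base ω)) ∂P := by
  have : IsProbabilityMeasure (P.map (erasePts base)) :=
    Measure.isProbabilityMeasure_map (by fun_prop)
  have hm := hR.measurable_pi k
  have h := congrArg (fun m => ∫ p, f p ∂m) (hR.map_ptAt_erasePts k)
  rwa [integral_map (by fun_prop) hf.measurable.aestronglyMeasurable,
    integral_map hm.aemeasurable hf.measurable.aestronglyMeasurable,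
    integral_prod _ ((hf.comp hm).integrable _),
    integral_map (by fun_prop) ((hf.comp hm).integral volume).measurable.aestronglyMeasurable] at h

end Points

lemma bddMeas_pattern {k : ℕ} (F : SimpleGraph (Fin k)) : BddMeas (pattern F) := by
  refine .of_mem_Icc (measurable_pattern F) fun ω => ?_
  have h1 := prod_mem_Icc (s := Finset.univ.filter fun p : Fin k × Fin k => p.1 < p.2)
    fun p _ => edgeFactor_mem F p (ω.2 (.inl p.1) (.inl p.2)).2
  have h2 := orderInd_mem fun i : Fin k => ω.1 (.inl i)
  exact ⟨mul_nonneg h1.1 h2.1, mul_le_one₀ h1.2 h2.1 h2.2⟩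

lemma IsSampleLike.integral_pattern_mul (hP : IsSampleLike P) {k : ℕ} (F : SimpleGraph (Fin k))
    {h : Arr → ℝ} (hh : BddMeas h) :
    ∫ ω, pattern F ω * h (erasePts base ω) ∂P =
      (∫ ω, pattern F ω ∂P) * ∫ ω, h (erasePts base ω) ∂P := by
  have hpat : ∀ ω, pattern F (erasePts baseᶜ ω) = pattern F ω := fun ω => by
    simp [pattern, erasePts, erase, base]
  have hpm := bddMeas_pattern F
  have := congrArg (fun m => ∫ p, pattern F p.1 * h p.2 ∂m) hP.indep
  simp only [integral_prod_mul] at this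
  rw [integral_map (by fun_prop)
    ((hpm.comp measurable_fst).mul (hh.comp measurable_snd)).measurable.aestronglyMeasurable,
    integral_map (by fun_prop) hpm.measurable.aestronglyMeasurable,
    integral_map (by fun_prop) hh.measurable.aestronglyMeasurable] at this
  simpa only [hpat] using this

/-- Every sample-like array has the pattern frequencies of an orderon. -/
theorem IsSampleLike.exists_orderon (hP : IsSampleLike P) :
    ∃ W : USq → USq → ℝ, IsOrderon W ∧ ∀ (k : ℕ) (F : SimpleGraph (Fin k)),
      homDensity F W = k.factorial * ∫ ω, pattern F ω ∂P := by
  obtain ⟨w, hw⟩ := hP.exists_isEdgeKernel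
  obtain ⟨R, hR⟩ := hP.exists_isPointKernel
  have hD : ∀ (k : ℕ) (F : SimpleGraph (Fin k)), ∀ᵐ ω ∂P, ∫ v : Fin k → USq,
      (∏ p ∈ Finset.univ.filter (fun p : Fin k × Fin k => p.1 < p.2),
        edgeFactor F p (w (erasePts base ω) (R (erasePts base ω) (v p.1))
          (R (erasePts base ω) (v p.2)))) * orderInd (fun i => (v i).1) =
        ∫ ω, pattern F ω ∂P := by
    intro k F
    set S := Finset.univ.filter fun p : Fin k × Fin k => p.1 < p.2 with hS
    have hS' : ∀ p ∈ S, p.1 < p.2 := fun p hp => (Finset.mem_filter.1 hp).2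
    have hord : BddMeas fun x : Fin k → Pt => orderInd fun i => (x i).1 :=
      .of_mem_Icc (by fun_prop) fun _ => orderInd_mem _
    have hf : BddMeas fun x : (Fin k → Pt) × Arr =>
        (∏ p ∈ S, edgeFactor F p (w x.2 (x.1 p.1) (x.1 p.2))) * orderInd fun i => (x.1 i).1 :=
      (BddMeas.prod fun p _ => (hw.bddMeas_edgeFactor F p).comp
        (φ := fun x : (Fin k → Pt) × Arr => (x.2, x.1 p.1, x.1 p.2)) (by fun_prop)).mul
        (hord.comp measurable_fst)
    have hDm := (hf.comp (hR.measurable_pi k)).integral volume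
    simp only [hR.fst_eq] at hDm
    refine ae_eq_of_integral_mul_eq (P := P) (measurable_erasePts base) hDm
      (.const (∫ ω, pattern F ω ∂P)) fun h hh => ?_
    have h1 := hw.integral_prod_edgeFactor_mul F S hS'
      (H := fun ω => orderInd (fun i : Fin k => (ptAt i ω).1) * h (erasePts base ω))
      ((hord.comp (φ := fun ω (i : Fin k) => ptAt i ω) (by fun_prop)).mul
        (hh.comp (measurable_erasePts base))) fun i j ω => by
          simp only [ptAt_erasePair, erasePts_base_erasePair]
    have h2 := hR.integral_ptAt_erasePts (hf.mul (hh.comp measurable_snd))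
    simp only [hR.fst_eq] at h2
    simp only [integral_mul_const] at h2
    simp only [← mul_assoc] at h1
    rw [integral_const_mul, ← hP.integral_pattern_mul F hh, ← h2, ← h1]
    rfl
  have hall : ∀ᵐ ω ∂P, ∀ (k : ℕ) (F : SimpleGraph (Fin k)), ∫ v : Fin k → USq,
      (∏ p ∈ Finset.univ.filter (fun p : Fin k × Fin k => p.1 < p.2),
        edgeFactor F p (w (erasePts base ω) (R (erasePts base ω) (v p.1))
          (R (erasePts base ω) (v p.2)))) * orderInd (fun i => (v i).1) =
        ∫ ω, pattern F ω ∂P :=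
    ae_all_iff.2 fun k => ae_all_iff.2 fun F => hD k F
  obtain ⟨ω, hω⟩ := hall.exists
  refine ⟨fun u v => w (erasePts base ω) (R (erasePts base ω) u) (R (erasePts base ω) v),
    ⟨?_, fun _ _ => hw.mem_Icc _ _ _, fun _ _ => hw.symm _ _ _⟩, fun k F => ?_⟩
  · have hRω : Measurable (R (erasePts base ω)) := hR.measurable.comp measurable_prodMk_left
    exact hw.measurable.comp (by fun_prop : Measurable fun x : USq × USq =>
      (erasePts base ω, R (erasePts base ω) x.1, R (erasePts base ω) x.2))
  · rw [homDensity_eq, hω]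

end Representation

/-! ### Graphs as orderons -/

lemma isOrderon_graphOrderon {n : ℕ} (G : SimpleGraph (Fin n)) : IsOrderon (graphOrderon G) := by
  refine ⟨?_, fun u v => ?_, fun u v => ?_⟩
  · have hQ : Measurable fun u : USq => Qn n (u.1 : ℝ) := by
      unfold Qn; fun_prop
    have hG : Measurable (Function.uncurry (graphAdjFun G)) := measurable_from_prod_countable_left
      fun _ => measurable_from_nat
    exact hG.comp ((hQ.comp measurable_fst).prodMk (hQ.comp measurable_snd))
  · unfold graphOrderon blockOrderon graphAdjFun
    split_ifs <;> simp
  · unfold graphOrderon blockOrderon graphAdjFun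
    by_cases h : Qn n (u.1 : ℝ) - 1 < n ∧ Qn n (v.1 : ℝ) - 1 < n
    · rw [dif_pos h, dif_pos h.symm, G.adj_comm]
    · rw [dif_neg h, dif_neg fun h' => h h'.symm]

end Orderon

/-- Every convergent sequence of simple ordered graphs (with the number of vertices
tending to infinity) has an orderon limit: there is an orderon `W` with
`t(F,Gₙ) → t(F,W)` for every simple ordered graph `F`. -/
theorem convergent_graph_sequence_has_limit
    (m : ℕ → ℕ) (hm : Tendsto m atTop atTop)
    (G : ∀ n : ℕ, SimpleGraph (Fin (m n)))
    (hconv : ∀ (k : ℕ) (F : SimpleGraph (Fin k)), ∃ L : ℝ,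
      Tendsto (fun n => homDensity F (graphOrderon (G n))) atTop (nhds L)) :
    ∃ W : USq → USq → ℝ, IsOrderon W ∧
      ∀ (k : ℕ) (F : SimpleGraph (Fin k)),
        Tendsto (fun n => homDensity F (graphOrderon (G n))) atTop
          (nhds (homDensity F W)) := by
  let μ : ℕ → ProbabilityMeasure Orderon.Arr := fun n =>
    Orderon.sampleLaw (Orderon.isOrderon_graphOrderon (G n))
  obtain ⟨P, -, hP⟩ := isCompact_univ (X := ProbabilityMeasure Orderon.Arr)
    |>.ultrafilter_le_nhds ((hyperfilter ℕ).map μ) (by simp)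
  have hlim : Tendsto μ (hyperfilter ℕ) (nhds P) := hP
  have hμ : ∀ n, Orderon.IsSampleLike (μ n) := fun n => Orderon.isSampleLike_sampleLaw _
  have hPs := Orderon.IsSampleLike.of_tendsto hlim hμ
  obtain ⟨W, hW, hWF⟩ := hPs.exists_orderon
  refine ⟨W, hW, fun k F => ?_⟩
  obtain ⟨L, hL⟩ := hconv k F
  have h := (Orderon.tendsto_integral_pattern hlim hμ hPs F).const_mul (k.factorial : ℝ)
  rw [← hWF] at h
  simp only [μ, ← Orderon.homDensity_eq_integral_sampleLaw] at h
  rwa [tendsto_nhds_unique h (hL.mono_left Nat.hyperfilter_le_atTop)]
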